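/- For every λ ∈ X∨₊ there exist an integer n ≥ 0, elements μ₁, …, μₙ of M and elements w₁, …, wₙ of W such that λ = w₁μ₁ + ⋯ + wₙμₙ and every partial sum w₁μ₁ + ⋯ + wⱼμⱼ (for 1 ≤ j ≤ n) is dominant. -/

import Mathlib

open scoped BigOperators Classical

noncomputable section

/-- Data of a finite crystallographic root system in a pair of vector spaces `V`, `V'`
(in perfect duality via `pair`), with a chosen base `Δ` and a cocharacter lattice `X`. -/
structure RootSystemData (V V' : Type) [AddCommGroup V] [Module ℝ V]
    [FiniteDimensional ℝ V] [AddCommGroup V'] [Module ℝ V'] [FiniteDimensional ℝ V'] where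
  /-- The canonical pairing between `V` and `V'`. -/
  pair : V →ₗ[ℝ] V' →ₗ[ℝ] ℝ
  /-- The (finite) set of roots. -/
  R : Finset V
  /-- The coroot attached to a root. -/
  coroot : V → V'
  root_ne_zero : ∀ α ∈ R, α ≠ (0 : V)
  neg_mem : ∀ α ∈ R, -α ∈ R
  coroot_neg : ∀ α ∈ R, coroot (-α) = -coroot α
  pair_self_eq_two : ∀ α ∈ R, pair α (coroot α) = 2
  crystallographic : ∀ α ∈ R, ∀ β ∈ R, ∃ n : ℤ, pair α (coroot β) = (n : ℝ)
  reflect_root_mem : ∀ α ∈ R, ∀ β ∈ R, β - pair β (coroot α) • α ∈ R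
  reflect_coroot_mem : ∀ α ∈ R, ∀ β ∈ R,
    coroot β - pair α (coroot β) • coroot α ∈ coroot '' R
  /-- The chosen base (set of simple roots). -/
  Δ : Finset V
  base_subset : Δ ⊆ R
  base_indep : LinearIndependent ℝ (fun a : (Δ : Set V) => (a : V))
  base_generates : ∀ α ∈ R,
    α ∈ AddSubmonoid.closure (Δ : Set V) ∨ -α ∈ AddSubmonoid.closure (Δ : Set V)
  /-- The lattice `X∨`. -/
  X : AddSubgroup V'
  coroot_mem_X : ∀ α ∈ R, coroot α ∈ X
  X_le_span : (X : Set V') ⊆ (Submodule.span ℝ (coroot '' (R : Set V)) : Set V')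
  pair_X_int : ∀ α ∈ R, ∀ x ∈ X, ∃ n : ℤ, pair α x = (n : ℝ)

namespace RootSystemData

variable {V V' : Type} [AddCommGroup V] [Module ℝ V] [FiniteDimensional ℝ V]
  [AddCommGroup V'] [Module ℝ V'] [FiniteDimensional ℝ V']
  (D : RootSystemData V V')

/-- The set `R₊` of positive roots: roots which are `ℕ`-linear combinations of the base. -/
def Rpos : Finset V := D.R.filter fun α => α ∈ AddSubmonoid.closure (D.Δ : Set V)

/-- The coroot lattice `Q∨`. -/
def Qc : AddSubgroup V' := AddSubgroup.closure (D.coroot '' (D.R : Set V))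

/-- The positive cone `Q∨₊` generated by the coroots of the positive roots. -/
def Qpos : AddSubmonoid V' := AddSubmonoid.closure (D.coroot '' (D.Rpos : Set V))

/-- The dominance order: `ν ≤ λ` iff `λ - ν ∈ Q∨₊`. -/
def leQ (ν lam : V') : Prop := lam - ν ∈ D.Qpos

/-- Dominance: `ν` is dominant iff `⟨α, ν⟩ ≥ 0` for every positive root `α`. -/
def Dominant (ν : V') : Prop := ∀ α ∈ D.Rpos, 0 ≤ D.pair α ν

/-- The set `X∨₊` of dominant elements of the lattice. -/
def Xplus : Set V' := {x | x ∈ D.X ∧ D.Dominant x}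

/-- The set `M` of minimal elements of `X∨₊ \ {0}` for the dominance order. -/
def MSet : Set V' :=
  {μ | μ ∈ D.Xplus ∧ μ ≠ 0 ∧ ∀ ν ∈ D.Xplus, ν ≠ 0 → D.leQ ν μ → ν = μ}

/-- The reflection on `V` attached to a root `α`. -/
def reflV (α : V) (hα : α ∈ D.R) : V ≃ₗ[ℝ] V :=
  Module.reflection (show D.pair.flip (D.coroot α) α = 2 from D.pair_self_eq_two α hα)

/-- The reflection on `V'` attached to a root `α`. -/
def reflV' (α : V) (hα : α ∈ D.R) : V' ≃ₗ[ℝ] V' :=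
  Module.reflection (show D.pair α (D.coroot α) = 2 from D.pair_self_eq_two α hα)

/-- The Weyl group `W`, acting simultaneously on `V` (first component)
and on `V'` (second component); it is generated by the pairs of reflections
attached to the roots. -/
def weyl : Subgroup ((V ≃ₗ[ℝ] V) × (V' ≃ₗ[ℝ] V')) :=
  Subgroup.closure {g | ∃ α, ∃ hα : α ∈ D.R, g = (D.reflV α hα, D.reflV' α hα)}

/-- The orbit `Wμ` of `μ ∈ V'` under the Weyl group. -/
def Worbit (μ : V') : Set V' := {ν | ∃ g ∈ D.weyl, ν = g.2 μ}

/-- The set `Ω(λ) = {ν ∈ X∨ : wν ≤ λ for all w ∈ W}`. -/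
def Omega (lam : V') : Set V' :=
  {ν | ν ∈ D.X ∧ ∀ g ∈ D.weyl, D.leQ (g.2 ν) lam}

/-- Two roots are linked when they are non-orthogonal. -/
def Linked (α β : V) : Prop := α ∈ D.R ∧ β ∈ D.R ∧ D.pair α (D.coroot β) ≠ 0

/-- Two roots lie in the same irreducible component iff they are connected by a
chain of non-orthogonal roots. -/
def SameComponent (α β : V) : Prop := Relation.EqvGen D.Linked α β

/-- The half-sum `ρ` of the positive roots. -/
def rho : V := (2 : ℝ)⁻¹ • ∑ α ∈ D.Rpos, α

/-- A `W`-invariant inner product on `V'`. -/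
structure WInvInner where
  form : V' →ₗ[ℝ] V' →ₗ[ℝ] ℝ
  symm : ∀ x y, form x y = form y x
  posdef : ∀ x, x ≠ 0 → 0 < form x x
  invariant : ∀ g ∈ D.weyl, ∀ x y, form (g.2 x) (g.2 y) = form x y

/-- `β` is a root whose coroot is short: for every `W`-invariant inner product `B` on `V'`,
`B(β∨, β∨) ≤ B(α∨, α∨)` for every root `α` in the same irreducible component as `β`. -/
def IsShortCoroot (β : V) : Prop :=
  β ∈ D.R ∧ ∀ B : D.WInvInner, ∀ α ∈ D.R, D.SameComponent α β →
    B.form (D.coroot β) (D.coroot β) ≤ B.form (D.coroot α) (D.coroot α)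

end RootSystemData

namespace RootSystemData

variable {V V' : Type} [AddCommGroup V] [Module ℝ V] [FiniteDimensional ℝ V]
  [AddCommGroup V'] [Module ℝ V'] [FiniteDimensional ℝ V']
  (D : RootSystemData V V')

theorem reflV_apply (α : V) (hα : α ∈ D.R) (v : V) :
    D.reflV α hα v = v - D.pair v (D.coroot α) • α := by
  simp [reflV, Module.reflection_apply]

theorem reflV'_apply (α : V) (hα : α ∈ D.R) (x : V') :
    D.reflV' α hα x = x - D.pair α x • D.coroot α := by
  simp [reflV', Module.reflection_apply]

theorem reflV'_reflV' (α : V) (hα : α ∈ D.R) (x : V') :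
    D.reflV' α hα (D.reflV' α hα x) = x :=
  Module.involutive_reflection _ x

theorem reflV_reflV (α : V) (hα : α ∈ D.R) (x : V) :
    D.reflV α hα (D.reflV α hα x) = x :=
  Module.involutive_reflection _ x

theorem reflV_mem (α : V) (hα : α ∈ D.R) (β : V) (hβ : β ∈ D.R) : D.reflV α hα β ∈ D.R := by
  rw [reflV_apply]
  exact D.reflect_root_mem α hα β hβ

/-! ### Nondegeneracy on the span of the coroots -/

/-- The real span of the coroots. -/
def corootSpan : Submodule ℝ V' := Submodule.span ℝ (D.coroot '' (D.R : Set V))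

/-- The map `f ↦ ∑ f(c) c`, the sum running over the coroots `c`. -/
def sumCoroots : Module.Dual ℝ V' →ₗ[ℝ] V' :=
  ∑ c ∈ D.R.image D.coroot, (Module.Dual.eval ℝ V' c).smulRight c

theorem sumCoroots_apply (f : Module.Dual ℝ V') :
    D.sumCoroots f = ∑ c ∈ D.R.image D.coroot, f c • c := by
  simp [sumCoroots, LinearMap.sum_apply]

theorem range_sumCoroots : LinearMap.range D.sumCoroots = D.corootSpan := by
  have hle : LinearMap.range D.sumCoroots ≤ D.corootSpan := by
    rintro _ ⟨f, rfl⟩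
    rw [sumCoroots_apply]
    refine Submodule.sum_mem _ fun c hc => Submodule.smul_mem _ _ (Submodule.subset_span ?_)
    simpa using hc
  have hker : LinearMap.ker D.sumCoroots ≤ D.corootSpan.dualAnnihilator := by
    intro f hf
    have h0 : ∑ c ∈ D.R.image D.coroot, f c * f c = 0 := by
      have := congrArg f (LinearMap.mem_ker.1 hf)
      simpa [sumCoroots_apply] using this
    rw [Finset.sum_eq_zero_iff_of_nonneg (fun _ _ => mul_self_nonneg _)] at h0
    rw [Submodule.mem_dualAnnihilator]
    intro w hw
    have : D.corootSpan ≤ LinearMap.ker f := by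
      refine Submodule.span_le.2 ?_
      rintro _ ⟨α, hα, rfl⟩
      exact mul_self_eq_zero.1 (h0 _ (Finset.mem_image_of_mem _ hα))
    exact this hw
  refine Submodule.eq_of_le_of_finrank_le hle ?_
  have h1 := LinearMap.finrank_range_add_finrank_ker D.sumCoroots
  have h2 := Submodule.finrank_mono hker
  have h3 := Subspace.finrank_add_finrank_dualAnnihilator_eq D.corootSpan
  rw [Subspace.dual_finrank_eq] at h1
  omega

theorem sum_coroots_reflV' (α : V) (hα : α ∈ D.R) (F : V' → ℝ) :
    ∑ c ∈ D.R.image D.coroot, F (D.reflV' α hα c) = ∑ c ∈ D.R.image D.coroot, F c := by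
  have hmem : ∀ c ∈ D.R.image D.coroot, D.reflV' α hα c ∈ D.R.image D.coroot := by
    intro c hc
    obtain ⟨β, hβ, rfl⟩ := Finset.mem_image.1 hc
    obtain ⟨δ, hδ, h⟩ := D.reflect_coroot_mem α hα β hβ
    rw [reflV'_apply, ← h]
    exact Finset.mem_image_of_mem _ hδ
  exact Finset.sum_nbij' (D.reflV' α hα) (D.reflV' α hα) hmem hmem
    (fun c _ => D.reflV'_reflV' α hα c) (fun c _ => D.reflV'_reflV' α hα c) (fun _ _ => rfl)

theorem eq_zero_of_pair_eq_zero (x : V') (hx : x ∈ D.corootSpan)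
    (h : ∀ α ∈ D.R, D.pair α x = 0) : x = 0 := by
  rw [← range_sumCoroots] at hx
  obtain ⟨f, rfl⟩ := hx
  have hf : ∀ α ∈ D.R, f (D.coroot α) = 0 := by
    intro α hα
    have hsum : ∑ c ∈ D.R.image D.coroot, f c * D.pair α c = 0 := by
      simpa [sumCoroots_apply] using h α hα
    have hinv := D.sum_coroots_reflV' α hα (fun c => f c * D.pair α c)
    have hexp : ∀ c, f (D.reflV' α hα c) * D.pair α (D.reflV' α hα c)
        = f (D.coroot α) * (D.pair α c * D.pair α c) - f c * D.pair α c := by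
      intro c
      simp only [reflV'_apply, map_sub, map_smul, smul_eq_mul, D.pair_self_eq_two α hα]
      ring
    simp only [hexp, Finset.sum_sub_distrib, ← Finset.mul_sum, hsum, sub_zero] at hinv
    refine (mul_eq_zero.1 hinv).resolve_right (ne_of_gt ?_)
    refine Finset.sum_pos' (fun _ _ => mul_self_nonneg _)
      ⟨D.coroot α, Finset.mem_image_of_mem _ hα, ?_⟩
    rw [D.pair_self_eq_two α hα]
    norm_num
  rw [sumCoroots_apply]
  refine Finset.sum_eq_zero fun c hc => ?_
  obtain ⟨β, hβ, rfl⟩ := Finset.mem_image.1 hc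
  rw [hf β hβ, zero_smul]

theorem coroot_mem_corootSpan {α : V} (hα : α ∈ D.R) : D.coroot α ∈ D.corootSpan :=
  Submodule.subset_span ⟨α, hα, rfl⟩

/-! ### The canonical invariant form -/

/-- The bilinear form `(x, y) ↦ ∑ ⟨α, x⟩ ⟨α, y⟩`, the sum running over the roots `α`. -/
def rootForm : V' →ₗ[ℝ] V' →ₗ[ℝ] ℝ := ∑ α ∈ D.R, (D.pair α).smulRight (D.pair α)

theorem rootForm_apply (x y : V') :
    D.rootForm x y = ∑ α ∈ D.R, D.pair α x * D.pair α y := by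
  simp [rootForm, LinearMap.sum_apply]

theorem rootForm_comm (x y : V') : D.rootForm x y = D.rootForm y x := by
  simp only [rootForm_apply, mul_comm]

theorem rootForm_self_nonneg (x : V') : 0 ≤ D.rootForm x x := by
  rw [rootForm_apply]
  exact Finset.sum_nonneg fun _ _ => mul_self_nonneg _

theorem eq_zero_of_rootForm_self_nonpos {x : V'} (hx : x ∈ D.corootSpan)
    (h : D.rootForm x x ≤ 0) : x = 0 := by
  have h0 := le_antisymm h (D.rootForm_self_nonneg x)
  rw [rootForm_apply, Finset.sum_eq_zero_iff_of_nonneg (fun _ _ => mul_self_nonneg _)] at h0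
  exact D.eq_zero_of_pair_eq_zero x hx fun α hα => mul_self_eq_zero.1 (h0 α hα)

theorem rootForm_self_pos {x : V'} (hx : x ∈ D.corootSpan) (h : x ≠ 0) : 0 < D.rootForm x x :=
  lt_of_not_ge fun hle => h (D.eq_zero_of_rootForm_self_nonpos hx hle)

theorem pair_reflV (α : V) (hα : α ∈ D.R) (v : V) (x : V') :
    D.pair (D.reflV α hα v) x = D.pair v (D.reflV' α hα x) := by
  simp only [reflV_apply, reflV'_apply, map_sub, map_smul, LinearMap.sub_apply,
    LinearMap.smul_apply, smul_eq_mul]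
  ring

theorem rootForm_reflV' (α : V) (hα : α ∈ D.R) (x y : V') :
    D.rootForm (D.reflV' α hα x) y = D.rootForm x (D.reflV' α hα y) := by
  simp only [rootForm_apply]
  refine Finset.sum_nbij' (D.reflV α hα) (D.reflV α hα) (D.reflV_mem α hα) (D.reflV_mem α hα)
    (fun c _ => D.reflV_reflV α hα c) (fun c _ => D.reflV_reflV α hα c) fun β _ => ?_
  rw [pair_reflV, pair_reflV, reflV'_reflV']

theorem rootForm_coroot {α : V} (hα : α ∈ D.R) (x : V') :
    D.rootForm (D.coroot α) x
      = D.pair α x * D.rootForm (D.coroot α) (D.coroot α) / 2 := by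
  have h := D.rootForm_reflV' α hα (D.coroot α) x
  simp only [reflV'_apply, map_sub, map_smul, LinearMap.sub_apply, LinearMap.smul_apply,
    smul_eq_mul, D.pair_self_eq_two α hα] at h
  linarith

theorem rootForm_coroot_self_pos {α : V} (hα : α ∈ D.R) :
    0 < D.rootForm (D.coroot α) (D.coroot α) := by
  refine D.rootForm_self_pos (D.coroot_mem_corootSpan hα) fun h => ?_
  have := D.pair_self_eq_two α hα
  rw [h, map_zero] at this
  norm_num at this

theorem coroot_reflV (α : V) (hα : α ∈ D.R) (β : V) (hβ : β ∈ D.R) :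
    D.coroot (D.reflV α hα β) = D.reflV' α hα (D.coroot β) := by
  have hγ := D.reflV_mem α hα β hβ
  set γ := D.reflV α hα β with hγdef
  set k := D.rootForm (D.coroot γ) (D.coroot γ)
  set l := D.rootForm (D.coroot β) (D.coroot β)
  have hk : 0 < k := D.rootForm_coroot_self_pos hγ
  have hβs : D.reflV' α hα (D.coroot β) ∈ D.corootSpan := by
    rw [reflV'_apply]
    exact Submodule.sub_mem _ (D.coroot_mem_corootSpan hβ)
      (Submodule.smul_mem _ _ (D.coroot_mem_corootSpan hα))
  have hpair : D.pair γ (D.reflV' α hα (D.coroot β)) = 2 := by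
    rw [hγdef, pair_reflV, reflV'_reflV', D.pair_self_eq_two β hβ]
  have key : l • D.coroot γ - k • D.reflV' α hα (D.coroot β) = 0 := by
    refine D.eq_zero_of_rootForm_self_nonpos
      (Submodule.sub_mem _ (Submodule.smul_mem _ _ (D.coroot_mem_corootSpan hγ))
        (Submodule.smul_mem _ _ hβs)) (le_of_eq ?_)
    generalize hy : l • D.coroot γ - k • D.reflV' α hα (D.coroot β) = y
    have h1 : D.rootForm (D.coroot γ) y = D.pair γ y * k / 2 := D.rootForm_coroot hγ y
    have h2 : D.rootForm (D.reflV' α hα (D.coroot β)) y = D.pair γ y * l / 2 := by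
      rw [rootForm_reflV', D.rootForm_coroot hβ, ← pair_reflV]
    calc D.rootForm y y
        = D.rootForm (l • D.coroot γ - k • D.reflV' α hα (D.coroot β)) y := by rw [hy]
      _ = 0 := by
        simp only [map_sub, map_smul, LinearMap.sub_apply, LinearMap.smul_apply, smul_eq_mul,
          h1, h2]
        ring
  have h2 := congrArg (D.pair γ) key
  simp only [map_sub, map_smul, smul_eq_mul, hpair, D.pair_self_eq_two γ hγ, map_zero] at h2
  have hlk : l = k := by linarith
  rw [hlk, ← smul_sub] at key
  exact sub_eq_zero.1 ((smul_eq_zero.1 key).resolve_left (ne_of_gt hk))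

/-! ### Dominance and positive roots -/

theorem mem_Rpos {α : V} : α ∈ D.Rpos ↔ α ∈ D.R ∧ α ∈ AddSubmonoid.closure (D.Δ : Set V) := by
  simp [Rpos]

theorem base_subset_Rpos {α : V} (hα : α ∈ D.Δ) : α ∈ D.Rpos :=
  D.mem_Rpos.2 ⟨D.base_subset hα, AddSubmonoid.subset_closure hα⟩

theorem mem_Rpos_or_neg_mem_Rpos {α : V} (hα : α ∈ D.R) : α ∈ D.Rpos ∨ -α ∈ D.Rpos :=
  (D.base_generates α hα).imp (fun h => D.mem_Rpos.2 ⟨hα, h⟩)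
    fun h => D.mem_Rpos.2 ⟨D.neg_mem α hα, h⟩

theorem dominant_of_base {x : V'} (h : ∀ α ∈ D.Δ, 0 ≤ D.pair α x) : D.Dominant x := by
  intro α hα
  refine AddSubmonoid.closure_induction (motive := fun v _ => 0 ≤ D.pair v x) (fun v hv => h v hv)
    (by simp) (fun v w _ _ hv hw => ?_) (D.mem_Rpos.1 hα).2
  rw [map_add, LinearMap.add_apply]
  exact add_nonneg hv hw

theorem mem_corootSpan_of_mem_X {x : V'} (hx : x ∈ D.X) : x ∈ D.corootSpan := D.X_le_span hx

theorem coroot_mem_Qpos {α : V} (hα : α ∈ D.Rpos) : D.coroot α ∈ D.Qpos :=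
  AddSubmonoid.subset_closure ⟨α, hα, rfl⟩

theorem rootForm_Qpos_nonneg {q x : V'} (hq : q ∈ D.Qpos) (hx : D.Dominant x) :
    0 ≤ D.rootForm q x := by
  refine AddSubmonoid.closure_induction (motive := fun v _ => 0 ≤ D.rootForm v x) ?_
    (by simp) (fun v w _ _ hv hw => ?_) hq
  · rintro _ ⟨α, hα, rfl⟩
    have hα' := (D.mem_Rpos.1 hα).1
    rw [D.rootForm_coroot hα']
    have := hx α hα
    have := (D.rootForm_coroot_self_pos hα').le
    positivity
  · rw [map_add, LinearMap.add_apply]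
    exact add_nonneg hv hw

theorem exists_nat_rootForm_self {x : V'} (hx : x ∈ D.X) :
    ∃ n : ℕ, D.rootForm x x = n := by
  have : ∀ α : V, ∃ n : ℤ, α ∈ D.R → D.pair α x = n := by
    intro α
    by_cases hα : α ∈ D.R
    · obtain ⟨n, hn⟩ := D.pair_X_int α hα x hx
      exact ⟨n, fun _ => hn⟩
    · exact ⟨0, fun h => absurd h hα⟩
  choose n hn using this
  refine ⟨∑ α ∈ D.R, (n α).natAbs * (n α).natAbs, ?_⟩
  rw [rootForm_apply]
  push_cast
  refine Finset.sum_congr rfl fun α hα => ?_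
  rw [hn α hα]
  rw [Nat.cast_natAbs, ← Int.cast_mul, ← Int.cast_mul, abs_mul_abs_self]

/-- A linear form vanishing on one simple root and equal to one on the others. -/
theorem exists_dual_eq_zero_eq_one (α : V) :
    ∃ f : V →ₗ[ℝ] ℝ, ∀ δ ∈ D.Δ, f δ = if δ = α then 0 else 1 := by
  let b := Module.Basis.extend D.base_indep.linearIndepOn_id
  refine ⟨b.constr ℝ fun i => if (i : V) = α then 0 else 1, fun δ hδ => ?_⟩
  have hδ' := D.base_indep.linearIndepOn_id.subset_extend (Set.subset_univ _) (by simpa using hδ)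
  have := b.constr_basis ℝ (fun i => if (i : V) = α then (0 : ℝ) else 1) ⟨δ, hδ'⟩
  simpa [b, Module.Basis.extend_apply_self] using this

theorem neg_notMem_Rpos {α : V} (hα : α ∈ D.Δ) : -α ∉ D.Rpos := by
  intro h
  obtain ⟨f, hf⟩ := D.exists_dual_eq_zero_eq_one 0
  have hf1 : ∀ δ ∈ D.Δ, f δ = 1 := fun δ hδ => by
    rw [hf δ hδ, if_neg (D.root_ne_zero δ (D.base_subset hδ))]
  have key : 0 ≤ f (-α) := by
    refine AddSubmonoid.closure_induction (motive := fun v _ => 0 ≤ f v)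
      (fun v hv => by rw [hf1 v hv]; exact zero_le_one) (by simp) (fun v w _ _ hv hw => ?_)
      (D.mem_Rpos.1 h).2
    rw [map_add]
    exact add_nonneg hv hw
  rw [map_neg, hf1 α hα] at key
  linarith

/-- A simple reflection preserves positivity of every positive root outside the ray of the
simple root. -/
theorem reflV_mem_Rpos {α : V} (hα : α ∈ D.Δ) {β : V} (hβ : β ∈ D.Rpos)
    (hne : ∀ n : ℕ, 0 < n → β ≠ (n : ℝ) • α) : D.reflV α (D.base_subset hα) β ∈ D.Rpos := by
  obtain ⟨f, hf⟩ := D.exists_dual_eq_zero_eq_one α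
  have hfα : f α = 0 := by simp [hf α hα]
  have key : ∀ v ∈ AddSubmonoid.closure (D.Δ : Set V),
      0 ≤ f v ∧ (f v = 0 → ∃ n : ℕ, v = (n : ℝ) • α) := by
    intro v hv
    induction hv using AddSubmonoid.closure_induction with
    | mem v hv =>
      rw [hf v hv]
      split_ifs with h
      · exact ⟨le_rfl, fun _ => ⟨1, by simp [h]⟩⟩
      · exact ⟨zero_le_one, fun h => absurd h one_ne_zero⟩
    | zero => exact ⟨by simp, fun _ => ⟨0, by simp⟩⟩
    | add v w _ _ hv hw =>
      rw [map_add]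
      refine ⟨add_nonneg hv.1 hw.1, fun h => ?_⟩
      obtain ⟨n, hn⟩ := hv.2 (by linarith [hv.1, hw.1])
      obtain ⟨m, hm⟩ := hw.2 (by linarith [hv.1, hw.1])
      exact ⟨n + m, by rw [hn, hm, Nat.cast_add, add_smul]⟩
  obtain ⟨hβR, hβc⟩ := D.mem_Rpos.1 hβ
  have hβf : 0 < f β := by
    refine lt_of_le_of_ne (key β hβc).1 fun h => ?_
    obtain ⟨n, hn⟩ := (key β hβc).2 h.symm
    rcases Nat.eq_zero_or_pos n with rfl | hn0
    · exact D.root_ne_zero β hβR (by simpa using hn)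
    · exact hne n hn0 hn
  have hR := D.reflV_mem α (D.base_subset hα) β hβR
  refine (D.mem_Rpos_or_neg_mem_Rpos hR).resolve_right fun h => ?_
  have := (key _ (D.mem_Rpos.1 h).2).1
  simp only [reflV_apply, map_neg, map_sub, map_smul, hfα, smul_zero, sub_zero] at this
  linarith

/-- The number of positive roots taking a positive value on `x`. -/
def numPos (x : V') : ℕ := (D.Rpos.filter fun β => 0 < D.pair β x).card

theorem numPos_reflV'_lt {α : V} (hα : α ∈ D.Δ) {x : V'} (h : 0 < D.pair α x) :
    D.numPos (D.reflV' α (D.base_subset hα) x) < D.numPos x := by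
  have hαR := D.base_subset hα
  rw [numPos, ← Finset.card_image_of_injective _ (D.reflV α hαR).injective]
  refine Finset.card_lt_card (Finset.ssubset_iff_of_subset ?_ |>.2 ⟨α, ?_, ?_⟩)
  · intro γ hγ
    obtain ⟨β, hβ, rfl⟩ := Finset.mem_image.1 hγ
    obtain ⟨hβ, hpos⟩ := Finset.mem_filter.1 hβ
    rw [← pair_reflV] at hpos
    refine Finset.mem_filter.2 ⟨D.reflV_mem_Rpos hα hβ ?_, hpos⟩
    rintro n - rfl
    rw [map_smul, map_smul, LinearMap.smul_apply, pair_reflV, reflV'_apply, map_sub, map_smul,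
      D.pair_self_eq_two α hαR, smul_eq_mul, smul_eq_mul] at hpos
    have : (0 : ℝ) ≤ n := n.cast_nonneg
    nlinarith
  · exact Finset.mem_filter.2 ⟨D.base_subset_Rpos hα, h⟩
  · intro hmem
    obtain ⟨β, hβ, hβα⟩ := Finset.mem_image.1 hmem
    have hβ' : β = -α := by
      rw [← D.reflV_reflV α hαR β, hβα, reflV_apply, D.pair_self_eq_two α hαR]
      module
    exact D.neg_notMem_Rpos hα (hβ' ▸ (Finset.mem_filter.1 hβ).1)

/-! ### Dominant elements below a given one -/

theorem exists_removable {α : V} (hα : α ∈ D.Δ) {q : V'} (hq : q ∈ D.Qpos)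
    (hpos : 0 < D.pair α q) :
    ∃ β ∈ D.Rpos, (∃ n : ℕ, 0 < n ∧ β = (n : ℝ) • α) ∧ q - D.coroot β ∈ D.Qpos := by
  revert hpos
  refine AddSubmonoid.closure_induction (motive := fun q _ => 0 < D.pair α q →
    ∃ β ∈ D.Rpos, (∃ n : ℕ, 0 < n ∧ β = (n : ℝ) • α) ∧ q - D.coroot β ∈ D.Qpos) ?_
    (by simp) (fun v w hv' hw' hv hw hpos => ?_) hq
  · rintro _ ⟨β, hβ, rfl⟩ hpos
    by_cases hne : ∃ n : ℕ, 0 < n ∧ β = (n : ℝ) • α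
    · exact ⟨β, hβ, hne, by simp [D.Qpos.zero_mem]⟩
    · push Not at hne
      have hαR := D.base_subset hα
      have hβR := (D.mem_Rpos.1 hβ).1
      refine ⟨α, D.base_subset_Rpos hα, ⟨1, one_pos, by simp⟩, ?_⟩
      have h1 := D.coroot_mem_Qpos (D.reflV_mem_Rpos hα hβ hne)
      rw [D.coroot_reflV α hαR β hβR, reflV'_apply] at h1
      obtain ⟨n, hn⟩ := D.crystallographic α hαR β hβR
      rw [hn] at h1 hpos
      have hn0 : 0 < n := by exact_mod_cast hpos
      obtain ⟨k, rfl⟩ : ∃ k : ℕ, n = k + 1 := ⟨(n - 1).toNat, by omega⟩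
      have h2 := D.Qpos.nsmul_mem (D.coroot_mem_Qpos (D.base_subset_Rpos hα)) k
      convert D.Qpos.add_mem h1 h2 using 1
      rw [← Nat.cast_smul_eq_nsmul ℝ]
      push_cast
      module
  · rw [map_add] at hpos
    rcases lt_or_ge 0 (D.pair α v) with h | h
    · obtain ⟨β, hβ, hc, hm⟩ := hv h
      exact ⟨β, hβ, hc, by simpa [sub_add_eq_add_sub] using D.Qpos.add_mem hm hw'⟩
    · obtain ⟨β, hβ, hc, hm⟩ := hw (by linarith)
      exact ⟨β, hβ, hc, by simpa [add_sub_assoc] using D.Qpos.add_mem hv' hm⟩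

theorem natFloor_rootForm_self {x : V'} (hx : x ∈ D.X) :
    (⌊D.rootForm x x⌋₊ : ℝ) = D.rootForm x x := by
  obtain ⟨n, hn⟩ := D.exists_nat_rootForm_self hx
  rw [hn, Nat.floor_natCast]

/-- Between `y` and a dominant element above it there is a dominant element which is no longer
than `y`. -/
theorem exists_dominant_between {y lam : V'} (hy : y ∈ D.X) (hlam : D.Dominant lam)
    (hle : D.leQ y lam) :
    ∃ z ∈ D.Xplus, D.leQ y z ∧ D.leQ z lam ∧ D.rootForm z z ≤ D.rootForm y y := by
  obtain ⟨z, ⟨hzX, hyz, hzl, hzy⟩, hmin⟩ := exists_minimalFor_of_wellFoundedLT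
    (fun z => z ∈ D.X ∧ D.leQ y z ∧ D.leQ z lam ∧ D.rootForm z z ≤ D.rootForm y y)
    (fun z => toLex (⌊D.rootForm z z⌋₊, D.numPos (-z)))
    ⟨y, hy, by simp [leQ, D.Qpos.zero_mem], hle, le_rfl⟩
  refine ⟨z, ⟨hzX, D.dominant_of_base fun α hα => ?_⟩, hyz, hzl, hzy⟩
  by_contra! hneg
  have hαR := D.base_subset hα
  obtain ⟨β, hβ, ⟨n, hn, rfl⟩, hq⟩ := D.exists_removable hα hzl (by
    rw [map_sub]
    linarith [hlam α (D.base_subset_Rpos hα)])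
  have hβR := (D.mem_Rpos.1 hβ).1
  obtain ⟨m, hm⟩ := D.pair_X_int α hαR z hzX
  have hm0 : m < 0 := by
    rw [hm] at hneg
    exact_mod_cast hneg
  have hpair : D.pair ((n : ℝ) • α) z = ((n * m : ℤ) : ℝ) := by
    rw [map_smul, LinearMap.smul_apply, hm, smul_eq_mul]
    push_cast
    rfl
  set β := (n : ℝ) • α with hβdef
  have hβpos := D.rootForm_coroot_self_pos hβR
  have hnorm : D.rootForm (z + D.coroot β) (z + D.coroot β)
      = D.rootForm z z + (D.pair β z + 1) * D.rootForm (D.coroot β) (D.coroot β) := by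
    simp only [map_add, LinearMap.add_apply, D.rootForm_comm z, D.rootForm_coroot hβR z]
    ring
  have hnm : n * m ≤ -1 := by nlinarith
  have hnmR : D.pair β z + 1 ≤ 0 := by
    rw [hpair]
    have : ((n * m : ℤ) : ℝ) ≤ (-1 : ℤ) := by exact_mod_cast hnm
    push_cast at this ⊢
    linarith
  have hz'X : z + D.coroot β ∈ D.X := D.X.add_mem hzX (D.coroot_mem_X β hβR)
  have hz'le : D.rootForm (z + D.coroot β) (z + D.coroot β) ≤ D.rootForm z z := by
    rw [hnorm]
    nlinarith
  have hmin' := hmin (j := z + D.coroot β) ⟨hz'X,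
    by simpa [leQ, sub_add_eq_add_sub] using D.Qpos.add_mem hyz (D.coroot_mem_Qpos hβ),
    by simpa [leQ, sub_sub] using hq, hz'le.trans hzy⟩
  have hlt : toLex (⌊D.rootForm (z + D.coroot β) (z + D.coroot β)⌋₊,
      D.numPos (-(z + D.coroot β))) < toLex (⌊D.rootForm z z⌋₊, D.numPos (-z)) := by
    rw [Prod.Lex.toLex_lt_toLex]
    rcases hnmR.lt_or_eq with h | h
    · left
      have : D.rootForm (z + D.coroot β) (z + D.coroot β) < D.rootForm z z := by
        rw [hnorm]
        nlinarith
      rw [← D.natFloor_rootForm_self hz'X, ← D.natFloor_rootForm_self hzX] at this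
      exact_mod_cast this
    · right
      refine ⟨by rw [hnorm, h, zero_mul, add_zero], ?_⟩
      have hnm1 : n * m = -1 := by
        rw [hpair] at h
        have h' : ((n * m + 1 : ℤ) : ℝ) = 0 := by exact_mod_cast h
        have h'' : (n * m + 1 : ℤ) = 0 := by exact_mod_cast h'
        linarith
      have hn1 : n = 1 := by
        have : (n : ℤ) ≤ 1 := by nlinarith
        omega
      have hβα : β = α := by simp [hβdef, hn1]
      have hm1 : D.pair α z = -1 := by
        rw [hβα] at h
        linarith
      have hlt := D.numPos_reflV'_lt hα (x := -z) (by rw [map_neg, hm1]; norm_num)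
      have hrefl : D.reflV' α hαR (-z) = -(z + D.coroot α) := by
        rw [reflV'_apply, map_neg, hm1]
        module
      rwa [hrefl, ← hβα] at hlt
  exact absurd (hmin' hlt.le) (not_le_of_gt hlt)

theorem rootForm_le_of_leQ {ν lam x : V'} (h : D.leQ ν lam) (hx : D.Dominant x) :
    D.rootForm ν x ≤ D.rootForm lam x := by
  have := D.rootForm_Qpos_nonneg h hx
  rw [map_sub, LinearMap.sub_apply] at this
  linarith

theorem rootForm_sub_self (x y : V') :
    D.rootForm (x - y) (x - y) = D.rootForm x x - 2 * D.rootForm x y + D.rootForm y y := by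
  simp only [map_sub, LinearMap.sub_apply, D.rootForm_comm y x]
  ring

/-! ### The set `M` -/

theorem exists_mem_MSet_leQ {lam : V'} (hlam : lam ∈ D.Xplus) (h0 : lam ≠ 0) :
    ∃ μ ∈ D.MSet, D.leQ μ lam := by
  obtain ⟨μ, ⟨hμ, hμ0, hμl⟩, hmin⟩ := exists_minimalFor_of_wellFoundedLT
    (fun ν => ν ∈ D.Xplus ∧ ν ≠ 0 ∧ D.leQ ν lam) (fun ν => ⌊D.rootForm ν ν⌋₊)
    ⟨lam, hlam, h0, by simp [leQ, D.Qpos.zero_mem]⟩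
  refine ⟨μ, ⟨hμ, hμ0, fun ν hν hν0 hle => ?_⟩, hμl⟩
  have hνl : D.leQ ν lam := by simpa [leQ] using D.Qpos.add_mem hμl hle
  have h1 := D.rootForm_le_of_leQ hle hμ.2
  have h2 := D.rootForm_le_of_leQ hle hν.2
  rw [D.rootForm_comm μ ν] at h2
  have h3 : D.rootForm μ μ ≤ D.rootForm ν ν := by
    have : ⌊D.rootForm μ μ⌋₊ ≤ ⌊D.rootForm ν ν⌋₊ :=
      hmin ⟨hν, hν0, hνl⟩ (Nat.floor_mono (h2.trans h1))
    rw [← D.natFloor_rootForm_self hμ.1, ← D.natFloor_rootForm_self hν.1]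
    exact_mod_cast this
  refine sub_eq_zero.1 (D.eq_zero_of_rootForm_self_nonpos
    (D.mem_corootSpan_of_mem_X (D.X.sub_mem hν.1 hμ.1)) ?_)
  rw [rootForm_sub_self]
  linarith

theorem eq_coroot_of_two_le_pair {μ : V'} (hμ : μ ∈ D.MSet) {γ : V} (hγ : γ ∈ D.Rpos)
    (h : 2 ≤ D.pair γ μ) : μ = D.coroot γ := by
  obtain ⟨hμX, -, hμmin⟩ := hμ
  have hγR := (D.mem_Rpos.1 hγ).1
  have hγX := D.coroot_mem_X γ hγR
  have hpos := D.rootForm_coroot_self_pos hγR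
  have hform := D.rootForm_coroot hγR μ
  obtain ⟨z, hz, hyz, hzμ, hnorm⟩ := D.exists_dominant_between (D.X.sub_mem hμX.1 hγX) hμX.2
    (by simpa [leQ] using D.coroot_mem_Qpos hγ)
  have hz0 : z = 0 := by
    by_contra hz0
    rw [hμmin z hz hz0 hzμ, rootForm_sub_self, D.rootForm_comm μ (D.coroot γ), hform] at hnorm
    nlinarith
  have hle : D.leQ μ (D.coroot γ) := by simpa [leQ, hz0] using hyz
  have hμγ := D.rootForm_le_of_leQ hle hμX.2
  refine sub_eq_zero.1 (D.eq_zero_of_rootForm_self_nonpos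
    (D.mem_corootSpan_of_mem_X (D.X.sub_mem hμX.1 hγX)) ?_)
  rw [rootForm_sub_self, D.rootForm_comm μ (D.coroot γ)]
  nlinarith

/-! ### The Weyl group action -/

theorem weyl_fst_mem_iff {g : (V ≃ₗ[ℝ] V) × (V' ≃ₗ[ℝ] V')} (hg : g ∈ D.weyl) :
    ∀ v, g.1 v ∈ D.R ↔ v ∈ D.R := by
  induction hg using Subgroup.closure_induction with
  | mem g hg =>
    obtain ⟨α, hα, rfl⟩ := hg
    intro v
    refine ⟨fun h => ?_, D.reflV_mem α hα v⟩
    rw [← D.reflV_reflV α hα v]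
    exact D.reflV_mem α hα _ h
  | one => exact fun _ => Iff.rfl
  | mul g h _ _ hg hh => exact fun v => (hg (h.1 v)).trans (hh v)
  | inv g _ hg =>
    intro v
    rw [← hg, Prod.fst_inv, ← LinearEquiv.mul_apply, mul_inv_cancel, LinearEquiv.coe_one, id_eq]

theorem weyl_pair {g : (V ≃ₗ[ℝ] V) × (V' ≃ₗ[ℝ] V')} (hg : g ∈ D.weyl) :
    ∀ v x, D.pair (g.1 v) (g.2 x) = D.pair v x := by
  induction hg using Subgroup.closure_induction with
  | mem g hg =>
    obtain ⟨α, hα, rfl⟩ := hg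
    intro v x
    rw [pair_reflV, reflV'_reflV']
  | one => exact fun _ _ => rfl
  | mul g h _ _ hg hh => exact fun v x => (hg (h.1 v) (h.2 x)).trans (hh v x)
  | inv g _ hg =>
    intro v x
    rw [← hg, Prod.fst_inv, Prod.snd_inv, ← LinearEquiv.mul_apply, mul_inv_cancel,
      ← LinearEquiv.mul_apply, mul_inv_cancel, LinearEquiv.coe_one, LinearEquiv.coe_one,
      id_eq, id_eq]

theorem weyl_snd_mem_X {g : (V ≃ₗ[ℝ] V) × (V' ≃ₗ[ℝ] V')} (hg : g ∈ D.weyl) :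
    ∀ x, g.2 x ∈ D.X ↔ x ∈ D.X := by
  have hrefl : ∀ α (hα : α ∈ D.R), ∀ x ∈ D.X, D.reflV' α hα x ∈ D.X := by
    intro α hα x hx
    obtain ⟨n, hn⟩ := D.pair_X_int α hα x hx
    rw [reflV'_apply, hn, Int.cast_smul_eq_zsmul]
    exact D.X.sub_mem hx (D.X.zsmul_mem (D.coroot_mem_X α hα) n)
  induction hg using Subgroup.closure_induction with
  | mem g hg =>
    obtain ⟨α, hα, rfl⟩ := hg
    intro x
    refine ⟨fun h => ?_, hrefl α hα x⟩
    rw [← D.reflV'_reflV' α hα x]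
    exact hrefl α hα _ h
  | one => exact fun _ => Iff.rfl
  | mul g h _ _ hg hh => exact fun x => (hg (h.2 x)).trans (hh x)
  | inv g _ hg =>
    intro x
    rw [← hg, Prod.snd_inv, ← LinearEquiv.mul_apply, mul_inv_cancel, LinearEquiv.coe_one, id_eq]

theorem rootForm_weyl {g : (V ≃ₗ[ℝ] V) × (V' ≃ₗ[ℝ] V')} (hg : g ∈ D.weyl) (x y : V') :
    D.rootForm (g.2 x) (g.2 y) = D.rootForm x y := by
  simp only [rootForm_apply]
  symm
  refine Finset.sum_nbij g.1 (fun v hv => (D.weyl_fst_mem_iff hg v).2 hv)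
    g.1.injective.injOn (fun v hv => ?_) fun v _ => ?_
  · obtain ⟨u, rfl⟩ := g.1.surjective v
    exact ⟨u, (D.weyl_fst_mem_iff hg u).1 hv, rfl⟩
  · rw [D.weyl_pair hg, D.weyl_pair hg]

/-! ### Subtracting a conjugate of an element of `M` -/

theorem exists_weyl_dominant_sub {lam μ : V'} (hlam : lam ∈ D.Xplus) (hμ : μ ∈ D.MSet)
    (hle : D.leQ μ lam) :
    ∃ g ∈ D.weyl, D.rootForm lam (g.2 μ) = D.rootForm lam μ ∧ D.Dominant (lam - g.2 μ) := by
  obtain ⟨g, ⟨hg, hgl⟩, hmin⟩ := exists_minimalFor_of_wellFoundedLT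
    (fun g : (V ≃ₗ[ℝ] V) × (V' ≃ₗ[ℝ] V') =>
      g ∈ D.weyl ∧ D.rootForm lam (g.2 μ) = D.rootForm lam μ)
    (fun g => D.numPos (g.2 μ)) ⟨1, D.weyl.one_mem, rfl⟩
  refine ⟨g, hg, hgl, D.dominant_of_base fun α hα => ?_⟩
  by_contra! hneg
  rw [map_sub] at hneg
  have hαR := D.base_subset hα
  have hαl := hlam.2 α (D.base_subset_Rpos hα)
  obtain ⟨a, ha⟩ := D.pair_X_int α hαR lam hlam.1
  obtain ⟨b, hb⟩ := D.pair_X_int α hαR (g.2 μ) ((D.weyl_snd_mem_X hg μ).2 hμ.1.1)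
  rw [ha] at hαl
  rw [ha, hb] at hneg
  have ha0 : 0 ≤ a := by exact_mod_cast hαl
  have hab : a < b := by exact_mod_cast sub_neg.1 hneg
  rcases le_or_gt 2 b with hb2 | hb2
  · obtain ⟨γ, rfl⟩ := g.1.surjective α
    obtain ⟨ν, rfl⟩ := g.2.surjective lam
    have hγR := (D.weyl_fst_mem_iff hg γ).1 hαR
    have hbγ := hb
    rw [D.weyl_pair hg] at hbγ ha
    have hγ2 : 2 ≤ D.pair γ μ := by
      rw [hbγ]
      exact_mod_cast hb2
    have hγ : γ ∈ D.Rpos := by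
      refine (D.mem_Rpos_or_neg_mem_Rpos hγR).resolve_right fun h => ?_
      have := hμ.1.2 _ h
      rw [map_neg, LinearMap.neg_apply] at this
      linarith
    have hμγ := D.eq_coroot_of_two_le_pair hμ hγ hγ2
    have hpos := D.rootForm_coroot_self_pos hγR
    have hform := D.rootForm_coroot hγR ν
    have h1 := D.rootForm_le_of_leQ hle hμ.1.2
    rw [← hgl, D.rootForm_weyl hg, D.rootForm_comm ν, hμγ, hform, ha] at h1
    rw [hμγ, D.pair_self_eq_two γ hγR] at hbγ
    have hab' : (a : ℝ) < b := by exact_mod_cast hab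
    nlinarith
  · obtain rfl : b = 1 := by omega
    obtain rfl : a = 0 := by omega
    have hlt := D.numPos_reflV'_lt hα (x := g.2 μ) (by rw [hb]; norm_num)
    refine absurd (hmin (j := (D.reflV α hαR, D.reflV' α hαR) * g) ⟨D.weyl.mul_mem
      (Subgroup.subset_closure ⟨α, hαR, rfl⟩) hg, ?_⟩ hlt.le) (not_le_of_gt hlt)
    change D.rootForm lam (D.reflV' α hαR (g.2 μ)) = _
    rw [← rootForm_reflV', reflV'_apply, ha, Int.cast_zero, zero_smul, sub_zero, hgl]

end RootSystemData

theorem dominant_sum_of_weyl_conjugates_of_M {V V' : Type} [AddCommGroup V] [Module ℝ V] [FiniteDimensional ℝ V]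
    [AddCommGroup V'] [Module ℝ V'] [FiniteDimensional ℝ V']
    (D : RootSystemData V V')
    (lam : V') (hlam : lam ∈ D.Xplus) :
    ∃ (n : ℕ) (μ : Fin n → V') (g : Fin n → (V ≃ₗ[ℝ] V) × (V' ≃ₗ[ℝ] V')),
      (∀ i, μ i ∈ D.MSet) ∧ (∀ i, g i ∈ D.weyl) ∧
      lam = ∑ i, (g i).2 (μ i) ∧
      ∀ j : Fin n,
        D.Dominant (∑ i ∈ Finset.univ.filter (fun i => i ≤ j), (g i).2 (μ i)) := by
  obtain ⟨N, hN⟩ : ∃ N : ℕ, D.rootForm lam lam < N := exists_nat_gt _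
  induction N generalizing lam with
  | zero => exact absurd hN (not_lt.2 (by simpa using D.rootForm_self_nonneg lam))
  | succ N ih =>
    rcases eq_or_ne lam 0 with rfl | h0
    · exact ⟨0, Fin.elim0, Fin.elim0, fun i => i.elim0, fun i => i.elim0, by simp,
        fun j => j.elim0⟩
    obtain ⟨ν, hν, hle⟩ := D.exists_mem_MSet_leQ hlam h0
    obtain ⟨w, hw, hwl, hdom⟩ := D.exists_weyl_dominant_sub hlam hν hle
    have hX : lam - w.2 ν ∈ D.X := D.X.sub_mem hlam.1 ((D.weyl_snd_mem_X hw ν).2 hν.1.1)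
    have hlt : D.rootForm (lam - w.2 ν) (lam - w.2 ν) < D.rootForm lam lam := by
      have h1 := D.rootForm_le_of_leQ hle hν.1.2
      have h2 := D.rootForm_self_pos (D.mem_corootSpan_of_mem_X hν.1.1) hν.2.1
      rw [D.rootForm_sub_self, hwl, D.rootForm_weyl hw]
      linarith
    obtain ⟨n, μ, g, hμ, hg, hsum, hpart⟩ := ih (lam - w.2 ν) ⟨hX, hdom⟩ (by
      rw [← D.natFloor_rootForm_self hlam.1] at hN hlt
      rw [← D.natFloor_rootForm_self hX] at hlt ⊢
      norm_cast at hN hlt ⊢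
      omega)
    have hlast : lam = ∑ i : Fin (n + 1), (Fin.snoc (α := fun _ => (V ≃ₗ[ℝ] V) × (V' ≃ₗ[ℝ] V'))
        g w i).2 (Fin.snoc (α := fun _ => V') μ ν i) := by
      simp [Fin.sum_univ_castSucc, ← hsum]
    refine ⟨n + 1, Fin.snoc μ ν, Fin.snoc g w, fun i => ?_, fun i => ?_, hlast, fun j => ?_⟩
    · cases i using Fin.lastCases <;> simp [hν, hμ]
    · cases i using Fin.lastCases <;> simp [hw, hg]
    · cases j using Fin.lastCases with
      | last =>
        rw [Finset.filter_true_of_mem fun i _ => Fin.le_last i, ← hlast]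
        exact hlam.2
      | cast j =>
        have h := hpart j
        rw [Finset.sum_filter] at h ⊢
        simpa [Fin.sum_univ_castSucc, not_le_of_gt (Fin.castSucc_lt_last j)] using h

end
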